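/- Fix a real constant c > 0. For each N let G(N, ⌊cN⌋) be the Erdős–Rényi directed multigraph on [N] with ⌊cN⌋ edges, and let C_N denote the maximum, over all maps x : [N] → {0,1}, of the number of edge indices m with x(i_m) ≠ x(j_m), where e_m = (i_m, j_m). Then there exists a constant H(c) such that C_N / N converges to H(c) with high probability as N → ∞. -/

import Mathlib

open Filter
open scoped Classical

/-- Probability of an event `p` when an edge list of `M` directed edges on vertex set
`Fin N` is drawn uniformly at random (i.e. the `M` edges are i.i.d. uniform ordered pairs). -/
noncomputable def probER (N M : ℕ) (p : (Fin M → Fin N × Fin N) → Prop) : ℝ :=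
  (((Finset.univ : Finset (Fin M → Fin N × Fin N)).filter p).card : ℝ) /
    (Fintype.card (Fin M → Fin N × Fin N) : ℝ)

/-- The MAX-CUT value of the edge list `E`: the maximum over `x : Fin N → Bool` of the
number of edge indices whose endpoints receive different values. -/
noncomputable def maxCutER {N M : ℕ} (E : Fin M → Fin N × Fin N) : ℕ :=
  Finset.sup (Finset.univ : Finset (Fin N → Bool)) (fun x =>
    ((Finset.univ : Finset (Fin M)).filter (fun m => x (E m).1 ≠ x (E m).2)).card)

section MaxCutInterpolation

open scoped BigOperators

variable {V W : Type}

/-- The number of edges of the multiset `s` that are cut by `x`. -/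
noncomputable def cutSize (x : V → Bool) (s : Multiset (V × V)) : ℕ :=
  s.countP fun e => x e.1 ≠ x e.2

lemma cutSize_cons (x : V → Bool) (e : V × V) (s : Multiset (V × V)) :
    cutSize x (e ::ₘ s) = cutSize x s + if x e.1 ≠ x e.2 then 1 else 0 := by
  simp only [cutSize, Multiset.countP_cons]

variable [Fintype V] [Fintype W]

/-- The MAX-CUT value of a multiset of directed edges. -/
noncomputable def multisetMaxCut (s : Multiset (V × V)) : ℕ :=
  Finset.univ.sup fun x : V → Bool => cutSize x s

/-- The same value as a real-valued functional. -/
noncomputable def maxCutFun (V : Type) [Fintype V] (s : Multiset (V × V)) : ℝ :=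
  multisetMaxCut s

lemma cutSize_le_multisetMaxCut (x : V → Bool) (s : Multiset (V × V)) :
    cutSize x s ≤ multisetMaxCut s :=
  Finset.le_sup (f := fun x : V → Bool => cutSize x s) (Finset.mem_univ x)

lemma exists_cutSize_eq (s : Multiset (V × V)) :
    ∃ x : V → Bool, cutSize x s = multisetMaxCut s := by
  obtain ⟨x, -, hx⟩ := Finset.exists_mem_eq_sup (Finset.univ : Finset (V → Bool))
    Finset.univ_nonempty (fun x => cutSize x s)
  exact ⟨x, hx.symm⟩

/-- Two vertices have the same optimal profile exactly when no maximum cut of `s` separates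
them. -/
noncomputable def optProfile (s : Multiset (V × V)) (v : V) : (V → Bool) → Bool :=
  fun x => decide (cutSize x s = multisetMaxCut s) && x v

lemma multisetMaxCut_cons (e : V × V) (s : Multiset (V × V)) :
    multisetMaxCut (e ::ₘ s) =
      multisetMaxCut s + if optProfile s e.1 = optProfile s e.2 then 0 else 1 := by
  apply le_antisymm
  · refine Finset.sup_le fun x _ => ?_
    rw [cutSize_cons]
    have h1 := cutSize_le_multisetMaxCut x s
    rcases h1.lt_or_eq with h | h
    · split_ifs <;> omega
    · by_cases hp : optProfile s e.1 = optProfile s e.2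
      · have := congrFun hp x
        simp only [optProfile, h, decide_true, Bool.true_and] at this
        simp [this, hp, h]
      · rw [if_neg hp]
        split_ifs <;> omega
  · by_cases hp : optProfile s e.1 = optProfile s e.2
    · obtain ⟨x, hx⟩ := exists_cutSize_eq s
      have h2 := cutSize_le_multisetMaxCut x (e ::ₘ s)
      rw [cutSize_cons] at h2
      rw [if_pos hp]
      omega
    · obtain ⟨x, hx⟩ := Function.ne_iff.mp hp
      have hx1 : cutSize x s = multisetMaxCut s := by
        by_contra hne
        simp [optProfile, hne] at hx
      have hx2 : x e.1 ≠ x e.2 := by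
        simpa [optProfile, hx1] using hx
      have h2 := cutSize_le_multisetMaxCut x (e ::ₘ s)
      rw [cutSize_cons, if_pos hx2] at h2
      rw [if_neg hp]
      omega

lemma maxCutFun_cons (e : V × V) (s : Multiset (V × V))
    [Decidable (optProfile s e.1 = optProfile s e.2)] :
    maxCutFun V (e ::ₘ s) =
      maxCutFun V s + 1 - if optProfile s e.1 = optProfile s e.2 then (1 : ℝ) else 0 := by
  by_cases hp : optProfile s e.1 = optProfile s e.2 <;>
    simp [maxCutFun, multisetMaxCut_cons, hp]

/-- The functional `g` is monotone and adding one edge raises it by at most one. -/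
def UnitIncrements (g : Multiset (V × V) → ℝ) : Prop :=
  ∀ e s, g s ≤ g (e ::ₘ s) ∧ g (e ::ₘ s) ≤ g s + 1

lemma unitIncrements_maxCutFun : UnitIncrements (maxCutFun V) := by
  intro e s
  rw [maxCutFun_cons]
  split_ifs <;> constructor <;> linarith

/-- Average a functional over adding one uniformly random directed edge. -/
noncomputable def addEdge (V : Type) [Fintype V] : Module.End ℝ (Multiset (V × V) → ℝ) where
  toFun g s := 𝔼 e : V × V, g (e ::ₘ s)
  map_add' f g := by
    ext s
    simp [Finset.expect_add_distrib]
  map_smul' a g := by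
    ext s
    simp [Finset.mul_expect]

lemma addEdge_apply (g : Multiset (V × V) → ℝ) (s : Multiset (V × V)) :
    addEdge V g s = 𝔼 e : V × V, g (e ::ₘ s) := rfl

lemma addEdge_mono : Monotone (addEdge V) := by
  intro f g h s
  exact Finset.expect_le_expect fun e _ => h _

lemma UnitIncrements.bounds_addEdge [Nonempty V] {g : Multiset (V × V) → ℝ}
    (hg : UnitIncrements g) (s : Multiset (V × V)) :
    g s ≤ addEdge V g s ∧ addEdge V g s ≤ g s + 1 := by
  constructor
  · calc g s = 𝔼 _e : V × V, g s := (Fintype.expect_const _).symm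
      _ ≤ _ := Finset.expect_le_expect fun e _ => (hg e s).1
  · calc addEdge V g s ≤ 𝔼 _e : V × V, (g s + 1) :=
        Finset.expect_le_expect fun e _ => (hg e s).2
      _ = _ := Fintype.expect_const _

lemma UnitIncrements.addEdge [Nonempty V] {g : Multiset (V × V) → ℝ}
    (hg : UnitIncrements g) : UnitIncrements (addEdge V g) := by
  intro e s
  constructor
  · refine Finset.expect_le_expect fun e' _ => ?_
    rw [Multiset.cons_swap]
    exact (hg _ _).1
  · calc _ ≤ 𝔼 e' : V × V, (g (e' ::ₘ s) + 1) := by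
          refine Finset.expect_le_expect fun e' _ => ?_
          rw [Multiset.cons_swap]
          exact (hg _ _).2
      _ = _ := by rw [Finset.expect_add_distrib, Fintype.expect_const]; rfl

lemma UnitIncrements.addEdge_pow [Nonempty V] {g : Multiset (V × V) → ℝ}
    (hg : UnitIncrements g) (M : ℕ) : UnitIncrements ((_root_.addEdge V ^ M) g) := by
  induction M with
  | zero => simpa using hg
  | succ M ih =>
    rw [pow_succ', Module.End.mul_apply]
    exact ih.addEdge

/-- The expected MAX-CUT value of `M` uniformly random directed edges on `V`. -/
noncomputable def meanMaxCut (V : Type) [Fintype V] (M : ℕ) : ℝ :=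
  (addEdge V ^ M) (maxCutFun V) 0

lemma meanMaxCut_succ_bounds [Nonempty V] (M : ℕ) :
    meanMaxCut V M ≤ meanMaxCut V (M + 1) ∧ meanMaxCut V (M + 1) ≤ meanMaxCut V M + 1 := by
  unfold meanMaxCut
  rw [pow_succ', Module.End.mul_apply]
  exact (unitIncrements_maxCutFun.addEdge_pow M).bounds_addEdge 0

lemma meanMaxCut_add_bounds [Nonempty V] (M k : ℕ) :
    meanMaxCut V M ≤ meanMaxCut V (M + k) ∧ meanMaxCut V (M + k) ≤ meanMaxCut V M + k := by
  induction k with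
  | zero => simp
  | succ k ih =>
    have := meanMaxCut_succ_bounds (V := V) (M + k)
    rw [← add_assoc]
    push_cast
    constructor <;> linarith

lemma meanMaxCut_zero : meanMaxCut V 0 = 0 := by
  simp [meanMaxCut, maxCutFun, multisetMaxCut, cutSize]

lemma meanMaxCut_bounds [Nonempty V] (M : ℕ) : 0 ≤ meanMaxCut V M ∧ meanMaxCut V M ≤ M := by
  have := meanMaxCut_add_bounds (V := V) 0 M
  simpa [meanMaxCut_zero] using this

lemma meanMaxCut_sub_le [Nonempty V] (j k : ℕ) :
    meanMaxCut V k - |(j : ℝ) - k| ≤ meanMaxCut V j := by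
  rcases le_total j k with h | h
  · obtain ⟨d, rfl⟩ := Nat.exists_eq_add_of_le h
    have := (meanMaxCut_add_bounds (V := V) j d).2
    have h3 := neg_abs_le ((j : ℝ) - (j + d : ℕ))
    push_cast at *
    linarith
  · obtain ⟨d, rfl⟩ := Nat.exists_eq_add_of_le h
    have := (meanMaxCut_add_bounds (V := V) k d).1
    have h3 := abs_nonneg (((k + d : ℕ) : ℝ) - k)
    linarith

/-- The mean over an explicit edge list equals the iterated averaging operator. -/
lemma expect_edgeList (M : ℕ) (g : Multiset (V × V) → ℝ) (s : Multiset (V × V)) :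
    𝔼 E : Fin M → V × V, g (Multiset.map E Finset.univ.val + s) = (addEdge V ^ M) g s := by
  induction M generalizing s with
  | zero => simp
  | succ M ih =>
    rw [pow_succ', Module.End.mul_apply, addEdge_apply]
    simp_rw [← ih]
    rw [← Finset.expect_product' (f := fun e (E : Fin M → V × V) =>
      g (Multiset.map E Finset.univ.val + e ::ₘ s)), Finset.univ_product_univ]
    refine (Fintype.expect_equiv (Fin.consEquiv fun _ : Fin (M + 1) => V × V) _ _ ?_).symm
    rintro ⟨e, E⟩
    congr 1
    simp [Fin.univ_succ, Fin.consEquiv, Function.comp_def, Multiset.add_cons]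
    rw [← Multiset.cons_coe, Multiset.cons_add]

/-- Variance bound for functionals with unit increments. -/
lemma addEdge_pow_sq_sub_le [Nonempty V] {g : Multiset (V × V) → ℝ} (hg : UnitIncrements g)
    (M : ℕ) (s : Multiset (V × V)) :
    (addEdge V ^ M) (g ^ 2) s ≤ ((addEdge V ^ M) g s) ^ 2 + M := by
  induction M generalizing s with
  | zero => simp
  | succ M ih =>
    rw [pow_succ', Module.End.mul_apply, Module.End.mul_apply, addEdge_apply]
    set h := (addEdge V ^ M) g with hh
    have hu : UnitIncrements h := hg.addEdge_pow M
    set m := addEdge V h s with hm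
    have hmb := hu.bounds_addEdge s
    have hdev : 𝔼 e : V × V, (h (e ::ₘ s) - m) ^ 2 ≤ 1 := by
      calc _ ≤ 𝔼 _e : V × V, (1 : ℝ) := by
            refine Finset.expect_le_expect fun e _ => ?_
            have := hu e s
            rw [sq_le_one_iff_abs_le_one, abs_le]
            constructor <;> linarith
        _ = 1 := Fintype.expect_const _
    have hexp : 𝔼 e : V × V, (h (e ::ₘ s) - m) ^ 2 = (𝔼 e : V × V, h (e ::ₘ s) ^ 2) - m ^ 2 := by
      have : ∀ e : V × V, (h (e ::ₘ s) - m) ^ 2 =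
          h (e ::ₘ s) ^ 2 - 2 * m * h (e ::ₘ s) + m ^ 2 := fun e => by ring
      simp_rw [this]
      rw [Finset.expect_add_distrib, Finset.expect_sub_distrib, ← Finset.mul_expect,
        Fintype.expect_const, ← addEdge_apply, ← hm]
      ring
    calc _ ≤ 𝔼 e : V × V, (h (e ::ₘ s) ^ 2 + M) :=
          Finset.expect_le_expect fun e _ => ih _
      _ = (𝔼 e : V × V, h (e ::ₘ s) ^ 2) + M := by
          rw [Finset.expect_add_distrib, Fintype.expect_const]
      _ ≤ _ := by push_cast; linarith

/-- The mean MAX-CUT depends only on the number of vertices. -/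
lemma meanMaxCut_congr (φ : V ≃ W) (M : ℕ) : meanMaxCut V M = meanMaxCut W M := by
  have hmax : ∀ s : Multiset (V × V),
      maxCutFun V s = maxCutFun W (s.map (Prod.map φ φ)) := by
    intro s
    unfold maxCutFun multisetMaxCut
    congr 1
    apply le_antisymm
    · refine Finset.sup_le fun x _ => ?_
      refine le_trans (le_of_eq ?_) (cutSize_le_multisetMaxCut (x ∘ φ.symm) _)
      rw [cutSize, cutSize, Multiset.countP_map, Multiset.countP_eq_card_filter]
      simp
    · refine Finset.sup_le fun x _ => ?_
      refine le_trans (le_of_eq ?_) (cutSize_le_multisetMaxCut (x ∘ φ) _)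
      rw [cutSize, cutSize, Multiset.countP_map, Multiset.countP_eq_card_filter]
      simp
  have hpow : ∀ s : Multiset (V × V),
      (addEdge V ^ M) (maxCutFun V) s =
        (addEdge W ^ M) (maxCutFun W) (s.map (Prod.map φ φ)) := by
    induction M with
    | zero => simpa using hmax
    | succ M ih =>
      intro s
      simp only [pow_succ', Module.End.mul_apply, addEdge_apply]
      refine Fintype.expect_equiv (φ.prodCongr φ) _ _ fun e => ?_
      rw [ih]
      simp [Equiv.prodCongr]
  simpa [meanMaxCut] using hpow 0

section Blocks

variable {B : Type} [Fintype B] {α : B → Type} [∀ b, Fintype (α b)] [∀ b, Nonempty (α b)]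

omit [Fintype B] [∀ b, Fintype (α b)] in
lemma nonempty_sigma_blocks [Nonempty B] : Nonempty (Σ b, α b) :=
  ⟨⟨Classical.arbitrary B, Classical.arbitrary _⟩⟩

omit [∀ b, Nonempty (α b)] in
lemma expect_sigma_fst (F : B → ℝ) :
    𝔼 v : Σ b, α b, F v.1 =
      (∑ b, (Fintype.card (α b) : ℝ) * F b) / Fintype.card (Σ b, α b) := by
  rw [Fintype.expect_eq_sum_div_card, Fintype.sum_sigma]
  simp

/-- Average a functional over adding a uniformly random edge inside the block of a uniformly
random vertex. -/
noncomputable def addBlockEdge (α : B → Type) [∀ b, Fintype (α b)] :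
    Module.End ℝ (Multiset ((Σ b, α b) × (Σ b, α b)) → ℝ) where
  toFun g s := 𝔼 v : Σ b, α b, 𝔼 e : α v.1 × α v.1, g ((⟨v.1, e.1⟩, ⟨v.1, e.2⟩) ::ₘ s)
  map_add' f g := by
    ext s
    simp [Finset.expect_add_distrib]
  map_smul' a g := by
    ext s
    simp [Finset.mul_expect]

omit [∀ b, Nonempty (α b)] in
lemma addBlockEdge_apply (g : Multiset ((Σ b, α b) × (Σ b, α b)) → ℝ)
    (s : Multiset ((Σ b, α b) × (Σ b, α b))) :
    addBlockEdge α g s =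
      𝔼 v : Σ b, α b, 𝔼 e : α v.1 × α v.1, g ((⟨v.1, e.1⟩, ⟨v.1, e.2⟩) ::ₘ s) := rfl

omit [∀ b, Nonempty (α b)] in
lemma addBlockEdge_mono : Monotone (addBlockEdge α) := by
  intro f g h s
  exact Finset.expect_le_expect fun v _ => Finset.expect_le_expect fun e _ => h _

omit [∀ b, Nonempty (α b)] in
lemma commute_addBlockEdge_addEdge :
    Function.Commute (addBlockEdge α) (addEdge (Σ b, α b)) := by
  intro g
  ext s
  simp only [addBlockEdge_apply, addEdge_apply]
  rw [Finset.expect_comm]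
  refine Finset.expect_congr rfl fun v _ => ?_
  rw [Finset.expect_comm]
  refine Finset.expect_congr rfl fun e _ => Finset.expect_congr rfl fun e' _ => ?_
  rw [Multiset.cons_swap]

/-- Uniformly random vertices collide under `κ` no more often than two vertices drawn from
the block of a uniformly random vertex. -/
lemma expect_collision_le [Nonempty B] {K : Type} [Fintype K] [DecidableEq K]
    (κ : (Σ b, α b) → K) :
    (𝔼 e : (Σ b, α b) × (Σ b, α b), if κ e.1 = κ e.2 then (1 : ℝ) else 0) ≤
      𝔼 v : Σ b, α b, 𝔼 e : α v.1 × α v.1,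
        if κ ⟨v.1, e.1⟩ = κ ⟨v.1, e.2⟩ then (1 : ℝ) else 0 := by
  have key : ∀ {U : Type} [Fintype U] (f : U → K),
      (𝔼 e : U × U, if f e.1 = f e.2 then (1 : ℝ) else 0) =
        ∑ k, (∑ u, if f u = k then (1 : ℝ) else 0) ^ 2 / (Fintype.card U : ℝ) ^ 2 := by
    intro U _ f
    rw [Fintype.expect_eq_sum_div_card, ← Finset.sum_div, Fintype.card_prod, Nat.cast_mul,
      ← pow_two]
    congr 1
    simp_rw [pow_two, Finset.sum_mul_sum, ← Finset.univ_product_univ, Finset.sum_product]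
    rw [Finset.sum_comm]
    conv_rhs => rw [Finset.sum_comm]; enter [2, u]; rw [Finset.sum_comm]
    rw [Finset.sum_comm]
    refine Finset.sum_congr rfl fun u _ => Finset.sum_congr rfl fun w _ => ?_
    simp [eq_comm]
  have hpos : ∀ b, (0 : ℝ) < Fintype.card (α b) := fun b => by
    exact_mod_cast Fintype.card_pos
  rw [key]
  simp_rw [fun v : Σ b, α b => key (fun u : α v.1 => κ ⟨v.1, u⟩)]
  rw [expect_sigma_fst fun b => ∑ k, (∑ u : α b, if κ ⟨b, u⟩ = k then (1 : ℝ) else 0) ^ 2 /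
    (Fintype.card (α b) : ℝ) ^ 2]
  simp_rw [Finset.mul_sum]
  rw [Finset.sum_comm, Finset.sum_div]
  refine Finset.sum_le_sum fun k _ => ?_
  rw [Fintype.sum_sigma]
  have := nonempty_sigma_blocks (α := α)
  have hN : (0 : ℝ) < Fintype.card (Σ b, α b) := by
    exact_mod_cast Fintype.card_pos
  rw [pow_two (Fintype.card (Σ b, α b) : ℝ), ← div_div]
  refine div_le_div_of_nonneg_right ?_ hN.le
  have := Finset.sq_sum_div_le_sum_sq_div Finset.univ
    (fun b => ∑ u : α b, if κ ⟨b, u⟩ = k then (1 : ℝ) else 0) (fun b _ => hpos b)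
  rw [Fintype.card_sigma, Nat.cast_sum]
  refine this.trans (le_of_eq (Finset.sum_congr rfl fun b _ => ?_))
  have := (hpos b).ne'
  field_simp

lemma addBlockEdge_maxCutFun_le [Nonempty B] :
    addBlockEdge α (maxCutFun (Σ b, α b)) ≤ addEdge (Σ b, α b) (maxCutFun (Σ b, α b)) := by
  intro s
  have := nonempty_sigma_blocks (α := α)
  have hW : addEdge (Σ b, α b) (maxCutFun (Σ b, α b)) s = maxCutFun (Σ b, α b) s + 1 -
      𝔼 e : (Σ b, α b) × (Σ b, α b),
        if optProfile s e.1 = optProfile s e.2 then (1 : ℝ) else 0 := by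
    simp_rw [addEdge_apply, maxCutFun_cons]
    rw [Finset.expect_sub_distrib, Fintype.expect_const]
  have hB : addBlockEdge α (maxCutFun (Σ b, α b)) s = maxCutFun (Σ b, α b) s + 1 -
      𝔼 v : Σ b, α b, 𝔼 e : α v.1 × α v.1,
        if optProfile s ⟨v.1, e.1⟩ = optProfile s ⟨v.1, e.2⟩ then (1 : ℝ) else 0 := by
    simp_rw [addBlockEdge_apply, maxCutFun_cons, Finset.expect_sub_distrib]
    simp_rw [Fintype.expect_const]
  have hC := expect_collision_le (optProfile s)
  rw [hW, hB]
  exact sub_le_sub_left hC _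

lemma addBlockEdge_pow_le [Nonempty B] (M : ℕ) :
    (addBlockEdge α ^ M) (maxCutFun (Σ b, α b)) 0 ≤ meanMaxCut (Σ b, α b) M := by
  rw [meanMaxCut, Module.End.pow_apply, Module.End.pow_apply]
  exact commute_addBlockEdge_addEdge.iterate_le_of_map_le addBlockEdge_mono addEdge_mono
    addBlockEdge_maxCutFun_le M 0

/-- The edge induced on block `b`, if both endpoints lie there. -/
noncomputable def blockEdge (b : B) (e : (Σ b, α b) × (Σ b, α b)) : Option (α b × α b) :=
  if h : e.1.1 = b ∧ e.2.1 = b then some (h.1 ▸ e.1.2, h.2 ▸ e.2.2) else none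

/-- The edges of `s` inside block `b`. -/
noncomputable def blockEdges (b : B) (s : Multiset ((Σ b, α b) × (Σ b, α b))) :
    Multiset (α b × α b) :=
  s.filterMap (blockEdge b)

omit [Fintype B] [∀ b, Fintype (α b)] [∀ b, Nonempty (α b)] in
lemma blockEdges_cons_self (b : B) (i j : α b) (s : Multiset ((Σ b, α b) × (Σ b, α b))) :
    blockEdges b ((⟨b, i⟩, ⟨b, j⟩) ::ₘ s) = (i, j) ::ₘ blockEdges b s := by
  refine Multiset.filterMap_cons_some _ _ _ ?_
  simp [blockEdge]

omit [Fintype B] [∀ b, Fintype (α b)] [∀ b, Nonempty (α b)] in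
lemma blockEdges_cons_of_ne {b : B} {e : (Σ b, α b) × (Σ b, α b)}
    (he : ¬ (e.1.1 = b ∧ e.2.1 = b)) (s : Multiset ((Σ b, α b) × (Σ b, α b))) :
    blockEdges b (e ::ₘ s) = blockEdges b s := by
  refine Multiset.filterMap_cons_none _ _ ?_
  simp only [blockEdge, dif_neg he]

omit [∀ b, Fintype (α b)] [∀ b, Nonempty (α b)] in
lemma sum_cutSize_blockEdges_le (x : (Σ b, α b) → Bool)
    (s : Multiset ((Σ b, α b) × (Σ b, α b))) :
    ∑ b, cutSize (fun i : α b => x ⟨b, i⟩) (blockEdges b s) ≤ cutSize x s := by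
  induction s using Multiset.induction_on with
  | empty => simp [cutSize, blockEdges]
  | cons e s ih =>
    obtain ⟨⟨b, i⟩, ⟨b', j⟩⟩ := e
    by_cases hb : b = b'
    · subst hb
      have : ∀ c, cutSize (fun i : α c => x ⟨c, i⟩)
          (blockEdges c ((⟨b, i⟩, ⟨b, j⟩) ::ₘ s)) =
          cutSize (fun i : α c => x ⟨c, i⟩) (blockEdges c s) +
            if c = b then (if x ⟨b, i⟩ ≠ x ⟨b, j⟩ then 1 else 0) else 0 := by
        intro c
        by_cases hc : c = b
        · subst hc
          rw [blockEdges_cons_self, cutSize_cons, if_pos rfl]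
        · rw [blockEdges_cons_of_ne (fun h => hc h.1.symm), if_neg hc, add_zero]
      simp_rw [this, Finset.sum_add_distrib]
      rw [Finset.sum_ite_eq' Finset.univ b, if_pos (Finset.mem_univ _), cutSize_cons]
      exact Nat.add_le_add_right ih _
    · rw [cutSize_cons]
      refine le_trans (le_of_eq (Finset.sum_congr rfl fun c _ => ?_)) (le_add_right ih)
      rw [blockEdges_cons_of_ne]
      rintro ⟨h1, h2⟩
      exact hb (h1.trans h2.symm)

omit [∀ b, Nonempty (α b)] in
lemma sum_maxCutFun_blockEdges_le (s : Multiset ((Σ b, α b) × (Σ b, α b))) :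
    ∑ b, maxCutFun (α b) (blockEdges b s) ≤ maxCutFun (Σ b, α b) s := by
  choose x hx using fun b => exists_cutSize_eq (blockEdges b s)
  unfold maxCutFun
  norm_cast
  simp_rw [← hx]
  exact (sum_cutSize_blockEdges_le (fun v => x v.1 v.2) s).trans (cutSize_le_multisetMaxCut _ _)

/-- With probability `p` add a uniformly random edge; otherwise do nothing. -/
noncomputable def lazyAddEdge (V : Type) [Fintype V] (p : ℝ) :
    Module.End ℝ (Multiset (V × V) → ℝ) :=
  p • addEdge V + (1 - p) • 1

lemma addBlockEdge_comp_blockEdges [Nonempty B] (b : B) (h : Multiset (α b × α b) → ℝ) :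
    addBlockEdge α (h ∘ blockEdges b) =
      (lazyAddEdge (α b) ((Fintype.card (α b) : ℝ) / Fintype.card (Σ b, α b)) h) ∘
        blockEdges b := by
  ext s
  have := nonempty_sigma_blocks (α := α)
  have hN : (0 : ℝ) < Fintype.card (Σ b, α b) := by
    exact_mod_cast Fintype.card_pos
  have hin : ∀ c, (𝔼 e : α c × α c, (h ∘ blockEdges b) ((⟨c, e.1⟩, ⟨c, e.2⟩) ::ₘ s)) =
      h (blockEdges b s) +
        if c = b then addEdge (α b) h (blockEdges b s) - h (blockEdges b s) else 0 := by
    intro c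
    by_cases hc : c = b
    · subst hc
      simp [blockEdges_cons_self, addEdge_apply]
    · rw [if_neg hc, add_zero, ← Fintype.expect_const (ι := α c × α c) (h (blockEdges b s))]
      refine Finset.expect_congr rfl fun e _ => ?_
      rw [Function.comp_apply, blockEdges_cons_of_ne fun h => hc h.1]
  rw [addBlockEdge_apply]
  simp_rw [fun v : Σ b, α b => hin v.1]
  rw [Finset.expect_add_distrib, Fintype.expect_const, expect_sigma_fst fun c =>
    if c = b then addEdge (α b) h (blockEdges b s) - h (blockEdges b s) else 0]
  simp only [mul_ite, mul_zero, Finset.sum_ite_eq', Finset.mem_univ, if_true,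
    Function.comp_apply, lazyAddEdge, LinearMap.add_apply, LinearMap.smul_apply, Pi.add_apply,
    Pi.smul_apply, smul_eq_mul, Module.End.one_apply]
  field_simp
  ring

lemma sum_lazyAddEdge_pow_le [Nonempty B] (M : ℕ) :
    ∑ b, (lazyAddEdge (α b) ((Fintype.card (α b) : ℝ) / Fintype.card (Σ b, α b)) ^ M)
      (maxCutFun (α b)) 0 ≤ meanMaxCut (Σ b, α b) M := by
  refine le_trans ?_ (addBlockEdge_pow_le M)
  have hpow : ∀ b (h : Multiset (α b × α b) → ℝ), (addBlockEdge α ^ M) (h ∘ blockEdges b) =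
      ((lazyAddEdge (α b) ((Fintype.card (α b) : ℝ) / Fintype.card (Σ b, α b)) ^ M) h) ∘
        blockEdges b := by
    intro b h
    induction M with
    | zero => simp
    | succ M ih =>
      rw [pow_succ', Module.End.mul_apply, ih, addBlockEdge_comp_blockEdges, pow_succ',
        Module.End.mul_apply]
  have hmono : Monotone ⇑(addBlockEdge α ^ M) := by
    rw [Module.End.coe_pow]
    exact addBlockEdge_mono.iterate M
  have hle : (∑ b, maxCutFun (α b) ∘ blockEdges b) ≤ maxCutFun (Σ b, α b) := fun s => by
    simpa using sum_maxCutFun_blockEdges_le s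
  have := hmono hle 0
  rw [map_sum] at this
  simp_rw [hpow] at this
  simpa [blockEdges] using this

end Blocks

/-- Mean absolute deviation of a binomial variable from `k`, bounded through its variance. -/
lemma sum_binomial_abs_sub_le {p t : ℝ} (hp0 : 0 ≤ p) (hp1 : p ≤ 1) (ht : 0 < t) (M : ℕ) (k : ℝ) :
    ∑ j ∈ Finset.range (M + 1), p ^ j * (1 - p) ^ (M - j) * (M.choose j : ℝ) * |(j : ℝ) - k| ≤
      (M * p / t + t) / 2 + |M * p - k| := by
  have hsum : ∑ j ∈ Finset.range (M + 1), p ^ j * (1 - p) ^ (M - j) * (M.choose j : ℝ) = 1 := by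
    rw [← add_pow]
    simp
  have hvar : ∑ j ∈ Finset.range (M + 1),
      p ^ j * (1 - p) ^ (M - j) * (M.choose j : ℝ) * (M * p - j) ^ 2 = M * p * (1 - p) := by
    have := congrArg (Polynomial.eval p) (bernsteinPolynomial.variance ℝ M)
    simp only [Polynomial.eval_finsetSum, bernsteinPolynomial, Polynomial.eval_mul,
      Polynomial.eval_pow, Polynomial.eval_sub, Polynomial.eval_X,
      Polynomial.eval_natCast, Polynomial.eval_one, nsmul_eq_mul] at this
    rw [← this]
    exact Finset.sum_congr rfl fun j _ => by ring
  have hpt : ∀ j : ℕ, |(j : ℝ) - k| ≤ ((M * p - j) ^ 2 / t + t) / 2 + |M * p - k| := by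
    intro j
    have h1 : |(j : ℝ) - k| ≤ |M * p - j| + |M * p - k| := by
      rw [abs_sub_comm (M * p) (j : ℝ)]
      exact abs_sub_le _ _ _
    have h2 : |M * p - j| ≤ ((M * p - j) ^ 2 / t + t) / 2 := by
      rw [← sq_abs, le_div_iff₀ two_pos, div_add' _ _ _ ht.ne', le_div_iff₀ ht]
      nlinarith [sq_nonneg (|M * p - j| - t)]
    linarith
  have h1p : 0 ≤ 1 - p := by linarith
  calc _ ≤ ∑ j ∈ Finset.range (M + 1), p ^ j * (1 - p) ^ (M - j) * (M.choose j : ℝ) *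
        (((M * p - j) ^ 2 / t + t) / 2 + |M * p - k|) :=
        Finset.sum_le_sum fun j _ => mul_le_mul_of_nonneg_left (hpt j) (by positivity)
    _ = (∑ j ∈ Finset.range (M + 1), p ^ j * (1 - p) ^ (M - j) * (M.choose j : ℝ) *
          (M * p - j) ^ 2) / (2 * t) +
        (∑ j ∈ Finset.range (M + 1), p ^ j * (1 - p) ^ (M - j) * (M.choose j : ℝ)) *
          (t / 2 + |M * p - k|) := by
        rw [Finset.sum_div, Finset.sum_mul, ← Finset.sum_add_distrib]
        refine Finset.sum_congr rfl fun j _ => ?_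
        field_simp
        ring
    _ = M * p * (1 - p) / (2 * t) + (t / 2 + |M * p - k|) := by rw [hsum, hvar, one_mul]
    _ ≤ M * p / (2 * t) + (t / 2 + |M * p - k|) := by
        have : M * p * (1 - p) ≤ M * p := mul_le_of_le_one_right (by positivity) (by linarith)
        gcongr
    _ = _ := by field_simp; ring

lemma lazyAddEdge_pow_eq (p : ℝ) (M : ℕ) :
    (lazyAddEdge V p ^ M) (maxCutFun V) 0 =
      ∑ j ∈ Finset.range (M + 1),
        p ^ j * (1 - p) ^ (M - j) * (M.choose j : ℝ) * meanMaxCut V j := by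
  have hc : Commute (p • addEdge V) ((1 - p) • (1 : Module.End ℝ (Multiset (V × V) → ℝ))) :=
    ((Commute.one_right _).smul_right _).smul_left _
  rw [lazyAddEdge, hc.add_pow]
  simp only [LinearMap.sum_apply, Finset.sum_apply]
  refine Finset.sum_congr rfl fun j _ => ?_
  rw [smul_pow, smul_pow, one_pow, ← nsmul_eq_mul', meanMaxCut]
  simp
  ring

lemma meanMaxCut_sub_le_lazyAddEdge_pow [Nonempty V] {p t : ℝ} (hp0 : 0 ≤ p) (hp1 : p ≤ 1)
    (ht : 0 < t) (M k : ℕ) :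
    meanMaxCut V k - ((M * p / t + t) / 2 + |M * p - k|) ≤
      (lazyAddEdge V p ^ M) (maxCutFun V) 0 := by
  have h1p : 0 ≤ 1 - p := by linarith
  have hsum : ∑ j ∈ Finset.range (M + 1), p ^ j * (1 - p) ^ (M - j) * (M.choose j : ℝ) = 1 := by
    rw [← add_pow]
    simp
  rw [lazyAddEdge_pow_eq]
  calc _ ≤ meanMaxCut V k - ∑ j ∈ Finset.range (M + 1),
          p ^ j * (1 - p) ^ (M - j) * (M.choose j : ℝ) * |(j : ℝ) - k| :=
        sub_le_sub_left (sum_binomial_abs_sub_le hp0 hp1 ht M k) _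
    _ = ∑ j ∈ Finset.range (M + 1), p ^ j * (1 - p) ^ (M - j) * (M.choose j : ℝ) *
          (meanMaxCut V k - |(j : ℝ) - k|) := by
        simp_rw [mul_sub]
        rw [Finset.sum_sub_distrib, ← Finset.sum_mul, hsum, one_mul]
    _ ≤ _ := Finset.sum_le_sum fun j _ =>
        mul_le_mul_of_nonneg_left (meanMaxCut_sub_le j k) (by positivity)

/-- Splitting `N` vertices into blocks of size `n` and a nonempty remainder. -/
lemma mul_lazyAddEdge_pow_le_meanMaxCut {n N : ℕ} (hn : 0 < n) (hN : 0 < N) (M : ℕ) :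
    (((N - 1) / n : ℕ) : ℝ) * (lazyAddEdge (Fin n) ((n : ℝ) / N) ^ M) (maxCutFun (Fin n)) 0 ≤
      meanMaxCut (Fin N) M := by
  set q := (N - 1) / n with hq
  let size : Option (Fin q) → ℕ := fun b => b.elim ((N - 1) % n + 1) fun _ => n
  have hsize : ∀ b, Nonempty (Fin (size b)) := by
    rintro (_ | b)
    · exact ⟨⟨0, Nat.succ_pos _⟩⟩
    · exact ⟨⟨0, hn⟩⟩
  have hcard : Fintype.card (Σ b, Fin (size b)) = N := by
    have := Nat.div_add_mod (N - 1) n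
    simp only [Fintype.card_sigma, Fintype.card_fin, Fintype.sum_option, size, Option.elim_none,
      Option.elim_some, Finset.sum_const, Finset.card_univ, smul_eq_mul]
    rw [← hq, mul_comm] at this
    omega
  have h := sum_lazyAddEdge_pow_le (α := fun b => Fin (size b)) M
  rw [hcard, Fintype.sum_option, meanMaxCut_congr (Fintype.equivFinOfCardEq hcard)] at h
  have hnone : 0 ≤ (lazyAddEdge (Fin (size none)) ((Fintype.card (Fin (size none)) : ℝ) / N) ^ M)
      (maxCutFun (Fin (size none))) 0 := by
    have hle : (Fintype.card (Fin (size none)) : ℝ) ≤ N := by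
      rw [← hcard, Fintype.card_sigma]
      exact_mod_cast Finset.single_le_sum (f := fun b => Fintype.card (Fin (size b)))
        (fun _ _ => Nat.zero_le _) (Finset.mem_univ none)
    have hN' : (0 : ℝ) < N := by exact_mod_cast hN
    have h1 : 0 ≤ 1 - (Fintype.card (Fin (size none)) : ℝ) / N :=
      sub_nonneg.mpr (div_le_one_of_le₀ hle hN'.le)
    rw [lazyAddEdge_pow_eq]
    have := fun j => (meanMaxCut_bounds (V := Fin (size none)) j).1
    exact Finset.sum_nonneg fun j _ => mul_nonneg (by positivity) (this j)
  have hsome : ∑ b : Fin q, (lazyAddEdge (Fin (size (some b)))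
      ((Fintype.card (Fin (size (some b))) : ℝ) / N) ^ M) (maxCutFun (Fin (size (some b)))) 0 =
      (q : ℝ) * (lazyAddEdge (Fin n) ((n : ℝ) / N) ^ M) (maxCutFun (Fin n)) 0 := by
    have hb : ∀ b : Fin q, (lazyAddEdge (Fin (size (some b)))
        ((Fintype.card (Fin (size (some b))) : ℝ) / N) ^ M) (maxCutFun (Fin (size (some b)))) 0 =
        (lazyAddEdge (Fin n) ((n : ℝ) / N) ^ M) (maxCutFun (Fin n)) 0 := fun b => by
      rw [Fintype.card_fin]
      rfl
    rw [Finset.sum_congr rfl fun b _ => hb b]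
    simp
  linarith

lemma meanMaxCut_almost_superadditive {c : ℝ} (hc : 0 < c) {n N : ℕ} (hn : 0 < n) (hN : n ≤ N) :
    (((N - 1) / n : ℕ) : ℝ) * (meanMaxCut (Fin n) ⌊c * n⌋₊ - (√(c * n) + 1)) ≤
      meanMaxCut (Fin N) ⌊c * N⌋₊ := by
  have hn' : (0 : ℝ) < n := by exact_mod_cast hn
  have hNN : (n : ℝ) ≤ N := by exact_mod_cast hN
  have hN' : (0 : ℝ) < N := hn'.trans_le hNN
  have : Nonempty (Fin n) := ⟨⟨0, hn⟩⟩
  refine le_trans (mul_le_mul_of_nonneg_left ?_ (Nat.cast_nonneg _))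
    (mul_lazyAddEdge_pow_le_meanMaxCut hn (hn.trans_le hN) _)
  have ht : 0 < √(c * n) := Real.sqrt_pos.mpr (by positivity)
  refine le_trans ?_ (meanMaxCut_sub_le_lazyAddEdge_pow (p := (n : ℝ) / N) (by positivity)
    (div_le_one_of_le₀ hNN hN'.le) ht _ ⌊c * n⌋₊)
  have hM1 := Nat.floor_le (a := c * N) (by positivity)
  have hM2 := Nat.lt_floor_add_one (c * N)
  have hk1 := Nat.floor_le (a := c * n) (by positivity)
  have hk2 := Nat.lt_floor_add_one (c * n)
  have hu : (⌊c * N⌋₊ : ℝ) * (n / N) ≤ c * n := by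
    rw [← mul_div_assoc, div_le_iff₀ hN']
    nlinarith
  have hl : c * n - 1 ≤ (⌊c * N⌋₊ : ℝ) * (n / N) := by
    rw [← mul_div_assoc, le_div_iff₀ hN']
    nlinarith
  have hd : |(⌊c * N⌋₊ : ℝ) * (n / N) - ⌊c * n⌋₊| ≤ 1 := by
    rw [abs_le]
    constructor <;> linarith
  have hs : (⌊c * N⌋₊ : ℝ) * (n / N) / √(c * n) ≤ √(c * n) := by
    rw [div_le_iff₀ ht, Real.mul_self_sqrt (by positivity)]
    exact hu
  linarith

lemma exists_tendsto_of_almost_superadditive {u : ℕ → ℝ} {c C : ℝ} (hu : ∀ n, 0 < n → u n ≤ C)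
    (h : ∀ n N : ℕ, 0 < n → n ≤ N →
      (((N - 1) / n : ℕ) : ℝ) * (n * u n - (√(c * n) + 1)) ≤ N * u N) :
    ∃ H, Tendsto u atTop (nhds H) := by
  let d : ℕ → ℝ := fun n => (√(c * n) + 1) / n
  have hd0 : ∀ n, 0 ≤ d n := fun n => by positivity
  have hd : Tendsto d atTop (nhds 0) := by
    have h1 : Tendsto (fun n : ℕ => √(c * (n : ℝ)⁻¹) + (n : ℝ)⁻¹) atTop (nhds 0) := by
      have := tendsto_inv_atTop_nhds_zero_nat (𝕜 := ℝ)
      simpa using ((this.const_mul c).sqrt).add this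
    refine h1.congr' ?_
    filter_upwards [eventually_gt_atTop 0] with n hn
    have hn' : (0 : ℝ) < n := by exact_mod_cast hn
    have : c * (n : ℝ)⁻¹ = c * n / n ^ 2 := by field_simp
    rw [this, Real.sqrt_div' _ (by positivity), Real.sqrt_sq hn'.le]
    simp only [d]
    ring
  let S : Set ℝ := (fun n => u n - d n) '' {n | 0 < n}
  have hbdd : BddAbove S := by
    refine ⟨C, ?_⟩
    rintro _ ⟨n, hn, rfl⟩
    have := hu n hn
    have := hd0 n
    simp only
    linarith
  have hne : S.Nonempty := ⟨_, 1, Nat.one_pos, rfl⟩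
  refine ⟨sSup S, tendsto_order.mpr ⟨fun a ha => ?_, fun a ha => ?_⟩⟩
  · obtain ⟨_, ⟨n, hn, rfl⟩, hlt⟩ := exists_lt_of_lt_csSup hne ha
    have hn : 0 < n := hn
    have hn' : (0 : ℝ) < n := by exact_mod_cast hn
    set x := u n - d n with hx
    have hlim : Tendsto (fun N : ℕ => x - |x| * n / (N : ℝ)) atTop (nhds x) := by
      simpa using (tendsto_const_div_atTop_nhds_zero_nat (|x| * n)).const_sub x
    filter_upwards [(tendsto_order.mp hlim).1 a hlt, eventually_ge_atTop n] with N hN hnN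
    refine hN.trans_le ?_
    have hN' : (0 : ℝ) < N := hn'.trans_le (by exact_mod_cast hnN)
    have hh := h n N hn hnN
    have hxe : n * u n - (√(c * n) + 1) = n * x := by
      simp only [hx, d]
      field_simp
    rw [hxe] at hh
    have hq := Nat.div_add_mod (N - 1) n
    have hr := Nat.mod_lt (N - 1) hn
    have hq1 : (n : ℝ) * ((N - 1) / n : ℕ) ≤ N := by
      exact_mod_cast (by omega : n * ((N - 1) / n) ≤ N)
    have hq2 : (N : ℝ) ≤ n * ((N - 1) / n : ℕ) + n := by
      exact_mod_cast (by omega : N ≤ n * ((N - 1) / n) + n)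
    have hmul : (N : ℝ) * (x - |x| * n / N) ≤ N * u N := by
      have : (N : ℝ) * (x - |x| * n / N) = N * x - |x| * n := by field_simp
      rw [this]
      refine le_trans ?_ hh
      have h1 : (N - n * ((N - 1) / n : ℕ)) * x ≤ (N - n * ((N - 1) / n : ℕ)) * |x| :=
        mul_le_mul_of_nonneg_left (le_abs_self x) (by linarith)
      have h2 : (N - n * ((N - 1) / n : ℕ)) * |x| ≤ n * |x| :=
        mul_le_mul_of_nonneg_right (by linarith) (abs_nonneg x)
      nlinarith
    exact le_of_mul_le_mul_left hmul hN'
  · filter_upwards [(tendsto_order.mp hd).2 (a - sSup S) (sub_pos.mpr ha),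
      eventually_gt_atTop 0] with n hn hn0
    have := le_csSup hbdd ⟨n, hn0, rfl⟩
    simp only at this
    linarith

lemma tendsto_meanMaxCut_div {c : ℝ} (hc : 0 < c) :
    ∃ H, Tendsto (fun N : ℕ => meanMaxCut (Fin N) ⌊c * (N : ℝ)⌋₊ / N) atTop (nhds H) := by
  have hmul : ∀ n : ℕ, 0 < n →
      (n : ℝ) * (meanMaxCut (Fin n) ⌊c * (n : ℝ)⌋₊ / n) = meanMaxCut (Fin n) ⌊c * (n : ℝ)⌋₊ :=
    fun n hn => mul_div_cancel₀ _ (by exact_mod_cast hn.ne')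
  refine exists_tendsto_of_almost_superadditive (c := c) (C := c) (fun n hn => ?_)
    fun n N hn hN => ?_
  · have hn' : (0 : ℝ) < n := by exact_mod_cast hn
    have : Nonempty (Fin n) := ⟨⟨0, hn⟩⟩
    rw [div_le_iff₀ hn']
    exact (meanMaxCut_bounds _).2.trans (Nat.floor_le (by positivity))
  · rw [hmul n hn, hmul N (hn.trans_le hN)]
    exact meanMaxCut_almost_superadditive hc hn hN

lemma maxCutER_eq {N M : ℕ} (E : Fin M → Fin N × Fin N) :
    (maxCutER E : ℝ) = maxCutFun (Fin N) (Multiset.map E Finset.univ.val) := by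
  simp only [maxCutFun, maxCutER, multisetMaxCut, cutSize, Multiset.countP_map]
  congr!

/-- Chebyshev's inequality for the MAX-CUT value of a random edge list. -/
lemma probER_le_of_deviation {N M : ℕ} (hN : 0 < N) {t : ℝ} (ht : 0 < t)
    {p : (Fin M → Fin N × Fin N) → Prop}
    (hp : ∀ E, p E → t ≤ |(maxCutER E : ℝ) - meanMaxCut (Fin N) M|) :
    probER N M p ≤ M / t ^ 2 := by
  have : Nonempty (Fin N) := ⟨⟨0, hN⟩⟩
  set m := meanMaxCut (Fin N) M with hm
  have hmean : 𝔼 E : Fin M → Fin N × Fin N, (maxCutER E : ℝ) = m := by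
    simp_rw [maxCutER_eq]
    have := expect_edgeList M (maxCutFun (Fin N)) 0
    simp_rw [add_zero] at this
    exact this
  have hsq : 𝔼 E : Fin M → Fin N × Fin N, (maxCutER E : ℝ) ^ 2 ≤ m ^ 2 + M := by
    simp_rw [maxCutER_eq]
    refine le_trans (le_of_eq ?_) (addEdge_pow_sq_sub_le unitIncrements_maxCutFun M 0)
    have := expect_edgeList M (maxCutFun (Fin N) ^ 2) 0
    simp_rw [add_zero] at this
    exact this
  have hvar : 𝔼 E : Fin M → Fin N × Fin N, ((maxCutER E : ℝ) - m) ^ 2 ≤ M := by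
    have : ∀ E : Fin M → Fin N × Fin N, ((maxCutER E : ℝ) - m) ^ 2 =
        (maxCutER E : ℝ) ^ 2 - 2 * m * maxCutER E + m ^ 2 := fun E => by ring
    simp_rw [this]
    rw [Finset.expect_add_distrib, Finset.expect_sub_distrib, ← Finset.mul_expect,
      Fintype.expect_const, hmean]
    linarith
  have hprob : probER N M p = 𝔼 E : Fin M → Fin N × Fin N, if p E then (1 : ℝ) else 0 := by
    rw [probER, Fintype.expect_eq_sum_div_card, Finset.sum_boole]
  rw [hprob]
  calc _ ≤ 𝔼 E : Fin M → Fin N × Fin N, ((maxCutER E : ℝ) - m) ^ 2 / t ^ 2 := by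
        refine Finset.expect_le_expect fun E _ => ?_
        split_ifs with h
        · rw [le_div_iff₀ (by positivity), one_mul, ← sq_abs (_ - m)]
          exact pow_le_pow_left₀ ht.le (hp E h) 2
        · positivity
    _ = (𝔼 E : Fin M → Fin N × Fin N, ((maxCutER E : ℝ) - m) ^ 2) / t ^ 2 :=
        (Finset.expect_div _ _ _).symm
    _ ≤ _ := by gcongr

end MaxCutInterpolation

/-- For the Erdős–Rényi multigraph `G(N, ⌊cN⌋)`, the MAX-CUT value normalized by `N`
converges with high probability to a constant `H(c)`. -/
theorem max_cut_scaling_limit_ER (c : ℝ) (hc : 0 < c) :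
    ∃ H : ℝ,
      ∀ ε : ℝ, 0 < ε →
        Tendsto (fun N : ℕ =>
            probER N ⌊c * (N : ℝ)⌋₊
              (fun E => ε < |(maxCutER E : ℝ) / (N : ℝ) - H|))
          atTop (nhds 0) := by
  obtain ⟨H, hH⟩ := tendsto_meanMaxCut_div hc
  refine ⟨H, fun ε hε => ?_⟩
  have hlim : Tendsto (fun N : ℕ => (4 * c / ε ^ 2) / (N : ℝ)) atTop (nhds 0) :=
    tendsto_const_div_atTop_nhds_zero_nat _
  refine tendsto_of_tendsto_of_tendsto_of_le_of_le' tendsto_const_nhds hlim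
    (Eventually.of_forall fun N => by unfold probER; positivity) ?_
  filter_upwards [Metric.tendsto_nhds.mp hH (ε / 2) (by positivity), eventually_gt_atTop 0]
    with N hN hN0
  have hN' : (0 : ℝ) < N := by exact_mod_cast hN0
  rw [Real.dist_eq] at hN
  refine (probER_le_of_deviation hN0 (t := ε / 2 * N) (by positivity) fun E hE => ?_).trans ?_
  · have h1 := abs_sub_le ((maxCutER E : ℝ) / N) (meanMaxCut (Fin N) ⌊c * (N : ℝ)⌋₊ / N) H
    rw [← sub_div, abs_div, abs_of_pos hN'] at h1
    rw [← le_div_iff₀ hN']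
    linarith
  · calc (⌊c * (N : ℝ)⌋₊ : ℝ) / (ε / 2 * N) ^ 2 ≤ c * N / (ε / 2 * N) ^ 2 := by
          gcongr
          exact Nat.floor_le (by positivity)
      _ = _ := by field_simp; norm_num
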